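/- arXiv:1012.2785 — 4 statements merged into one kernel-verified Lean document; each statement's English description precedes it below -/
import Mathlib

section
/- Let g : [0,∞) → ℝ be a nonnegative function defined on an interval [0,T) (T ≤ ∞), having at every point t ∈ [0,T) a bounded derivative from the right ġ(t) = lim_{s→0+} (g(t+s) − g(t))/s, and satisfying the differential inequality ġ(t) ≤ −γ(t)g(t) + α(t, g(t)) + β(t) for all t ∈ [0,T). Assume γ, β : [0,∞) → ℝ are continuous and nonnegative, and α : [0,∞) × [0,∞) → ℝ is continuous, nonnegative, nondecreasing in its second argument, and locally Lipschitz in its second argument uniformly in t on compact time intervals. Suppose there exists a positive function μ ∈ C¹([0,∞)) such that α(t, 1/μ(t)) + β(t) ≤ (1/μ(t))·(γ(t) − μ̇(t)/μ(t)) for all t ≥ 0, and μ(0)g(0) < 1. Then 0 ≤ g(t) < 1/μ(t) for all t ∈ [0,T). -/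
open Set Filter

/-- Theorem 1 of the paper (strict-inequality version): if a nonnegative function `g`
defined on `[0, T)` (with `T ≤ ∞`) has at every point a (bounded, i.e. real-valued)
derivative from the right `g'` satisfying
`g'(t) ≤ -γ(t) g(t) + α(t, g(t)) + β(t)`, and there exists a positive `C¹` function `μ`
with `α(t, 1/μ(t)) + β(t) ≤ (1/μ(t)) (γ(t) - μ'(t)/μ(t))` for all `t ≥ 0` and
`μ(0) g(0) < 1`, then `0 ≤ g(t) < 1/μ(t)` on `[0, T)`. -/
theorem nonlinear_differential_inequality_strict
    (T : EReal) (hT : 0 < T)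
    (g g' γ β μ μ' : ℝ → ℝ) (α : ℝ → ℝ → ℝ)
    (hgcont : ContinuousOn g {t : ℝ | 0 ≤ t ∧ (t : EReal) < T})
    (hgnonneg : ∀ t : ℝ, 0 ≤ t → (t : EReal) < T → 0 ≤ g t)
    (hgderiv : ∀ t : ℝ, 0 ≤ t → (t : EReal) < T → HasDerivWithinAt g (g' t) (Ici t) t)
    (hineq : ∀ t : ℝ, 0 ≤ t → (t : EReal) < T → g' t ≤ -γ t * g t + α t (g t) + β t)
    (hγcont : ContinuousOn γ (Ici 0)) (hγnonneg : ∀ t : ℝ, 0 ≤ t → 0 ≤ γ t)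
    (hβcont : ContinuousOn β (Ici 0)) (hβnonneg : ∀ t : ℝ, 0 ≤ t → 0 ≤ β t)
    (hαcont : ContinuousOn (fun q : ℝ × ℝ => α q.1 q.2) (Ici 0 ×ˢ Ici 0))
    (hαnonneg : ∀ t : ℝ, 0 ≤ t → ∀ x : ℝ, 0 ≤ x → 0 ≤ α t x)
    (hαmono : ∀ t : ℝ, 0 ≤ t → ∀ x y : ℝ, 0 ≤ x → x ≤ y → α t x ≤ α t y)
    (hαlip : ∀ T' > (0 : ℝ), ∀ M > (0 : ℝ), ∃ L > (0 : ℝ), ∀ t ∈ Icc (0 : ℝ) T',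
      ∀ x ∈ Icc (0 : ℝ) M, ∀ y ∈ Icc (0 : ℝ) M, |α t x - α t y| ≤ L * |x - y|)
    (hμpos : ∀ t : ℝ, 0 ≤ t → 0 < μ t)
    (hμderiv : ∀ t : ℝ, 0 ≤ t → HasDerivWithinAt μ (μ' t) (Ici 0) t)
    (hμ'cont : ContinuousOn μ' (Ici 0))
    (hcond : ∀ t : ℝ, 0 ≤ t → α t (1 / μ t) + β t ≤ (1 / μ t) * (γ t - μ' t / μ t))
    (hinit : μ 0 * g 0 < 1) :
    ∀ t : ℝ, 0 ≤ t → (t : EReal) < T → 0 ≤ g t ∧ g t < 1 / μ t := by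
  intro t ht0 htT
  refine ⟨hgnonneg t ht0 htT, ?_⟩
  have hlt : ∀ x ∈ Icc (0 : ℝ) t, (x : EReal) < T := fun x hx =>
    lt_of_le_of_lt (EReal.coe_le_coe_iff.2 hx.2) htT
  obtain ⟨C, hC⟩ := (isCompact_Icc (a := (0 : ℝ)) (b := t)).exists_bound_of_continuousOn
    (hγcont.mono (fun x hx => hx.1))
  have hd0 : 0 < 1 / μ 0 - g 0 := by
    have h0 := hμpos 0 le_rfl
    have : g 0 < 1 / μ 0 := by
      rw [lt_div_iff₀ h0]; linarith [mul_comm (μ 0) (g 0)]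
    linarith
  set d := 1 / μ 0 - g 0 with hd
  have hμc : ContinuousOn μ (Ici 0) := fun x hx => (hμderiv x hx).continuousWithinAt
  have key := image_le_of_deriv_right_lt_deriv_boundary' (f := g) (f' := g') (a := 0) (b := t)
    (B := fun s => (μ s)⁻¹ - d * Real.exp (-(C + 1) * s))
    (B' := fun s => -μ' s / μ s ^ 2 - d * (Real.exp (-(C + 1) * s) * (-(C + 1) * 1)))
    (hgcont.mono (fun x hx => ⟨hx.1, hlt x hx⟩))
    (fun x hx => hgderiv x hx.1 (hlt x ⟨hx.1, hx.2.le⟩))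
    (by simp [hd])
    (by
      refine ContinuousOn.sub ?_ (by fun_prop)
      exact (hμc.mono (fun x hx => hx.1)).inv₀ (fun x hx => (hμpos x hx.1).ne'))
    (by
      intro x hx
      have h1 := ((hμderiv x hx.1).mono (Ici_subset_Ici.2 hx.1)).fun_inv (hμpos x hx.1).ne'
      have h2 := ((((hasDerivAt_id x).const_mul (-(C + 1))).exp).const_mul d).hasDerivWithinAt
        (s := Ici x)
      exact h1.sub h2)
    (by
      intro x hx hgx
      have hxT := hlt x ⟨hx.1, hx.2.le⟩
      have hm := hμpos x hx.1
      have hγ := (le_abs_self _).trans (hC x ⟨hx.1, hx.2.le⟩)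
      have hE : 0 < d * Real.exp (-(C + 1) * x) := mul_pos hd0 (Real.exp_pos _)
      have hi := hineq x hx.1 hxT
      have hc := hcond x hx.1
      have hmono := hαmono x hx.1 (g x) (1 / μ x) (hgnonneg x hx.1 hxT)
        (by rw [one_div]; linarith)
      have e : (1 / μ x) * (γ x - μ' x / μ x) = γ x * (μ x)⁻¹ + -μ' x / μ x ^ 2 := by
        field_simp
        ring
      rw [e] at hc
      have hp := mul_le_mul_of_nonneg_right hγ hE.le
      have e2 : γ x * g x = γ x * (μ x)⁻¹ - γ x * (d * Real.exp (-(C + 1) * x)) := by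
        rw [hgx]; ring
      linarith)
  have h := key (right_mem_Icc.2 ht0)
  have hE : 0 < d * Real.exp (-(C + 1) * t) := mul_pos hd0 (Real.exp_pos _)
  rw [one_div]
  linarith
end

section
/- Let g : [0,∞) → ℝ be a nonnegative function defined on an interval [0,T) (T ≤ ∞), having at every point t ∈ [0,T) a bounded derivative from the right ġ(t) = lim_{s→0+} (g(t+s) − g(t))/s, and satisfying the differential inequality ġ(t) ≤ −γ(t)g(t) + α(t, g(t)) + β(t) for all t ∈ [0,T). Assume γ, β : [0,∞) → ℝ are continuous and nonnegative, and α : [0,∞) × [0,∞) → ℝ is continuous, nonnegative, nondecreasing in its second argument, and locally Lipschitz in its second argument uniformly in t on compact time intervals. Suppose there exists a positive function μ ∈ C¹([0,∞)) such that α(t, 1/μ(t)) + β(t) ≤ (1/μ(t))·(γ(t) − μ̇(t)/μ(t)) for all t ≥ 0, and μ(0)g(0) ≤ 1. Then 0 ≤ g(t) ≤ 1/μ(t) for all t ∈ [0,T). -/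
open Set Filter

/-- Theorem 1 of the paper (non-strict version): if a nonnegative function `g`
defined on `[0, T)` (with `T ≤ ∞`) has at every point a (bounded, i.e. real-valued)
derivative from the right `g'` satisfying
`g'(t) ≤ -γ(t) g(t) + α(t, g(t)) + β(t)`, and there exists a positive `C¹` function `μ`
with `α(t, 1/μ(t)) + β(t) ≤ (1/μ(t)) (γ(t) - μ'(t)/μ(t))` for all `t ≥ 0` and
`μ(0) g(0) ≤ 1`, then `0 ≤ g(t) ≤ 1/μ(t)` on `[0, T)`. -/
theorem nonlinear_differential_inequality
    (T : EReal) (hT : 0 < T)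
    (g g' γ β μ μ' : ℝ → ℝ) (α : ℝ → ℝ → ℝ)
    (hgcont : ContinuousOn g {t : ℝ | 0 ≤ t ∧ (t : EReal) < T})
    (hgnonneg : ∀ t : ℝ, 0 ≤ t → (t : EReal) < T → 0 ≤ g t)
    (hgderiv : ∀ t : ℝ, 0 ≤ t → (t : EReal) < T → HasDerivWithinAt g (g' t) (Ici t) t)
    (hineq : ∀ t : ℝ, 0 ≤ t → (t : EReal) < T → g' t ≤ -γ t * g t + α t (g t) + β t)
    (hγcont : ContinuousOn γ (Ici 0)) (hγnonneg : ∀ t : ℝ, 0 ≤ t → 0 ≤ γ t)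
    (hβcont : ContinuousOn β (Ici 0)) (hβnonneg : ∀ t : ℝ, 0 ≤ t → 0 ≤ β t)
    (hαcont : ContinuousOn (fun q : ℝ × ℝ => α q.1 q.2) (Ici 0 ×ˢ Ici 0))
    (hαnonneg : ∀ t : ℝ, 0 ≤ t → ∀ x : ℝ, 0 ≤ x → 0 ≤ α t x)
    (hαmono : ∀ t : ℝ, 0 ≤ t → ∀ x y : ℝ, 0 ≤ x → x ≤ y → α t x ≤ α t y)
    (hαlip : ∀ T' > (0 : ℝ), ∀ M > (0 : ℝ), ∃ L > (0 : ℝ), ∀ t ∈ Icc (0 : ℝ) T',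
      ∀ x ∈ Icc (0 : ℝ) M, ∀ y ∈ Icc (0 : ℝ) M, |α t x - α t y| ≤ L * |x - y|)
    (hμpos : ∀ t : ℝ, 0 ≤ t → 0 < μ t)
    (hμderiv : ∀ t : ℝ, 0 ≤ t → HasDerivWithinAt μ (μ' t) (Ici 0) t)
    (hμ'cont : ContinuousOn μ' (Ici 0))
    (hcond : ∀ t : ℝ, 0 ≤ t → α t (1 / μ t) + β t ≤ (1 / μ t) * (γ t - μ' t / μ t))
    (hinit : μ 0 * g 0 ≤ 1) :
    ∀ t : ℝ, 0 ≤ t → (t : EReal) < T → 0 ≤ g t ∧ g t ≤ 1 / μ t := by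
  intro b hb hbT
  refine ⟨hgnonneg b hb hbT, ?_⟩
  have hlt : ∀ t : ℝ, t ≤ b → (t : EReal) < T := fun t ht =>
    lt_of_le_of_lt (EReal.coe_le_coe_iff.2 ht) hbT
  have hgc : ContinuousOn g (Icc 0 b) := hgcont.mono fun t ht => ⟨ht.1, hlt t ht.2⟩
  have hμc : ContinuousOn μ (Icc 0 b) := fun t ht =>
    (hμderiv t ht.1).continuousWithinAt.mono Icc_subset_Ici_self
  have hic : ContinuousOn (fun t => (μ t)⁻¹) (Icc 0 b) :=
    hμc.inv₀ fun t ht => (hμpos t ht.1).ne'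
  obtain ⟨M₁, hM₁⟩ := isCompact_Icc.bddAbove_image hgc
  obtain ⟨M₂, hM₂⟩ := isCompact_Icc.bddAbove_image hic
  obtain ⟨L, hL, hlip⟩ := hαlip (b + 1) (by linarith) (max (max M₁ M₂) 1) (by positivity)
  have key : ∀ ε > (0 : ℝ), g b - (μ b)⁻¹ ≤ ε * Real.exp ((L + 1) * b) := by
    intro ε hε
    have hB : ∀ x : ℝ, HasDerivAt (fun t : ℝ => ε * Real.exp ((L + 1) * t))
        (ε * (Real.exp ((L + 1) * x) * ((L + 1) * 1))) x := fun x =>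
      (((hasDerivAt_id x).const_mul (L + 1)).exp).const_mul ε
    refine image_le_of_deriv_right_lt_deriv_boundary (f := fun t => g t - (μ t)⁻¹)
      (f' := fun t => g' t - (-μ' t / μ t ^ 2)) (a := 0) (b := b)
      (hgc.sub hic) ?_ ?_ hB ?_ (right_mem_Icc.2 hb)
    · intro x hx
      exact (hgderiv x hx.1 (hlt x hx.2.le)).sub
        (((hμderiv x hx.1).mono (Ici_subset_Ici.2 hx.1)).fun_inv (hμpos x hx.1).ne')
    · have h0 := hμpos 0 le_rfl
      have : g 0 ≤ (μ 0)⁻¹ := by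
        rw [← one_div, le_div_iff₀ h0]; linarith
      simp only [mul_zero, Real.exp_zero, mul_one]
      linarith
    · intro x hx hxe
      have hxe' : g x - (μ x)⁻¹ = ε * Real.exp ((L + 1) * x) := hxe
      have hm := hμpos x hx.1
      have hpos : 0 < ε * Real.exp ((L + 1) * x) := by positivity
      have hi : 0 < (μ x)⁻¹ := by positivity
      have hxI : x ∈ Icc 0 b := ⟨hx.1, hx.2.le⟩
      have h1 : g x ≤ M₁ := hM₁ (mem_image_of_mem _ hxI)
      have h2 : (μ x)⁻¹ ≤ M₂ := hM₂ (mem_image_of_mem (fun t => (μ t)⁻¹) hxI)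
      have h3 := hlip x ⟨hx.1, by linarith [hx.2]⟩ (g x)
        ⟨hgnonneg x hx.1 (hlt x hx.2.le), h1.trans ((le_max_left _ _).trans (le_max_left _ _))⟩
        (μ x)⁻¹ ⟨hi.le, h2.trans ((le_max_right _ _).trans (le_max_left _ _))⟩
      rw [hxe', abs_of_pos hpos] at h3
      have h4 := (le_abs_self _).trans h3
      have h5 := hineq x hx.1 (hlt x hx.2.le)
      have h6 := hcond x hx.1
      rw [one_div] at h6
      have h7 : (μ x)⁻¹ * (γ x - μ' x / μ x) = γ x * (μ x)⁻¹ + (-μ' x / μ x ^ 2) := by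
        field_simp
        ring
      have h8 : 0 ≤ γ x * (g x - (μ x)⁻¹) :=
        mul_nonneg (hγnonneg x hx.1) (by rw [hxe']; exact hpos.le)
      show g' x - (-μ' x / μ x ^ 2) < ε * (Real.exp ((L + 1) * x) * ((L + 1) * 1))
      nlinarith
  have hE := Real.exp_pos ((L + 1) * b)
  rw [one_div, ← sub_nonpos]
  refine le_of_forall_pos_le_add fun ε hε => ?_
  have := key (ε / Real.exp ((L + 1) * b)) (by positivity)
  rw [div_mul_cancel₀ _ hE.ne'] at this
  linarith
end

section
/- Let g : [0,∞) → ℝ be a nonnegative function defined on all of [0,∞), having at every point a bounded derivative from the right and satisfying ġ(t) ≤ −γ(t)g(t) + α(t, g(t)) + β(t) for all t ≥ 0, where γ, β : [0,∞) → ℝ are continuous and nonnegative, and α : [0,∞) × [0,∞) → ℝ is continuous, nonnegative, nondecreasing in its second argument, and locally Lipschitz in its second argument uniformly in t on compact time intervals. If there exists a positive μ ∈ C¹([0,∞)) with α(t, 1/μ(t)) + β(t) ≤ (1/μ(t))·(γ(t) − μ̇(t)/μ(t)) for all t ≥ 0, μ(0)g(0) ≤ 1, and lim_{t→∞} μ(t)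 = ∞, then lim_{t→∞} g(t) = 0. -/
open Set Filter

/-- Remark 1 of the paper: under the hypotheses of the nonlinear differential inequality
theorem, with `g` defined on all of `[0, ∞)`, if moreover `μ(t) → ∞` as `t → ∞`, then
`g(t) → 0` as `t → ∞`. -/
theorem nonlinear_differential_inequality_decay
    (g g' γ β μ μ' : ℝ → ℝ) (α : ℝ → ℝ → ℝ)
    (hgcont : ContinuousOn g (Ici 0))
    (hgnonneg : ∀ t : ℝ, 0 ≤ t → 0 ≤ g t)
    (hgderiv : ∀ t : ℝ, 0 ≤ t → HasDerivWithinAt g (g' t) (Ici t) t)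
    (hineq : ∀ t : ℝ, 0 ≤ t → g' t ≤ -γ t * g t + α t (g t) + β t)
    (hγcont : ContinuousOn γ (Ici 0)) (hγnonneg : ∀ t : ℝ, 0 ≤ t → 0 ≤ γ t)
    (hβcont : ContinuousOn β (Ici 0)) (hβnonneg : ∀ t : ℝ, 0 ≤ t → 0 ≤ β t)
    (hαcont : ContinuousOn (fun q : ℝ × ℝ => α q.1 q.2) (Ici 0 ×ˢ Ici 0))
    (hαnonneg : ∀ t : ℝ, 0 ≤ t → ∀ x : ℝ, 0 ≤ x → 0 ≤ α t x)
    (hαmono : ∀ t : ℝ, 0 ≤ t → ∀ x y : ℝ, 0 ≤ x → x ≤ y → α t x ≤ α t y)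
    (hαlip : ∀ T' > (0 : ℝ), ∀ M > (0 : ℝ), ∃ L > (0 : ℝ), ∀ t ∈ Icc (0 : ℝ) T',
      ∀ x ∈ Icc (0 : ℝ) M, ∀ y ∈ Icc (0 : ℝ) M, |α t x - α t y| ≤ L * |x - y|)
    (hμpos : ∀ t : ℝ, 0 ≤ t → 0 < μ t)
    (hμderiv : ∀ t : ℝ, 0 ≤ t → HasDerivWithinAt μ (μ' t) (Ici 0) t)
    (hμ'cont : ContinuousOn μ' (Ici 0))
    (hcond : ∀ t : ℝ, 0 ≤ t → α t (1 / μ t) + β t ≤ (1 / μ t) * (γ t - μ' t / μ t))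
    (hinit : μ 0 * g 0 ≤ 1)
    (hμtop : Tendsto μ atTop atTop) :
    Tendsto g atTop (nhds 0) := by
  have hμcont : ContinuousOn μ (Ici 0) := fun t ht => (hμderiv t ht).continuousWithinAt
  have hhcont : ContinuousOn (fun t => 1 / μ t) (Ici 0) :=
    continuousOn_const.div hμcont (fun t ht => (hμpos t ht).ne')
  have key : ∀ T : ℝ, 0 < T → g T ≤ 1 / μ T := by
    intro T hT
    have hsub : Icc (0 : ℝ) T ⊆ Ici 0 := fun x hx => hx.1
    obtain ⟨M₁, hM₁⟩ := (isCompact_Icc.image_of_continuousOn (hgcont.mono hsub)).bddAbove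
    obtain ⟨M₂, hM₂⟩ := (isCompact_Icc.image_of_continuousOn (hhcont.mono hsub)).bddAbove
    have hg1 : ∀ t ∈ Icc (0 : ℝ) T, g t ≤ M₁ := fun t ht => hM₁ (mem_image_of_mem _ ht)
    have hh1 : ∀ t ∈ Icc (0 : ℝ) T, 1 / μ t ≤ M₂ := fun t ht => hM₂ ⟨t, ht, rfl⟩
    obtain ⟨L, hL, hlip⟩ := hαlip T hT (max 1 (max M₁ M₂)) (lt_max_of_lt_left one_pos)
    have main : ∀ ε : ℝ, 0 < ε → g T ≤ 1 / μ T + ε * Real.exp ((L + 1) * T) := by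
      intro ε hε
      have hB' : ∀ x ∈ Ico (0 : ℝ) T, HasDerivWithinAt
          (fun t => 1 / μ t + ε * Real.exp ((L + 1) * t))
          (-μ' x / μ x ^ 2 + ε * (Real.exp ((L + 1) * x) * ((L + 1) * 1))) (Ici x) x := by
        intro x hx
        have h1 := ((hμderiv x hx.1).mono (Ici_subset_Ici.mpr hx.1)).inv (hμpos x hx.1).ne'
        have h2 := ((((hasDerivAt_id x).const_mul (L + 1)).exp).const_mul ε).hasDerivWithinAt
          (s := Ici x)
        simp only [one_div]
        exact h1.add h2
      refine image_le_of_deriv_right_lt_deriv_boundary' (f' := g') (hgcont.mono hsub)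
        (fun x hx => hgderiv x hx.1) (B := fun t => 1 / μ t + ε * Real.exp ((L + 1) * t))
        ?_ ?_ hB' ?_ (right_mem_Icc.mpr hT.le)
      · have h0 : g 0 ≤ 1 / μ 0 := by
          rw [le_div_iff₀ (hμpos 0 le_rfl)]; linarith
        have := Real.exp_pos ((L + 1) * 0)
        have := mul_pos hε this
        show g 0 ≤ 1 / μ 0 + _
        linarith
      · exact (hhcont.mono hsub).add (by fun_prop)
      · intro x hx heq
        have hxi : x ∈ Icc (0 : ℝ) T := ⟨hx.1, hx.2.le⟩
        have hw := mul_pos hε (Real.exp_pos ((L + 1) * x))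
        have hμx := hμpos x hx.1
        have hpos : 0 < 1 / μ x := by positivity
        have hl := hlip x hxi (g x) ⟨hgnonneg x hx.1, (hg1 x hxi).trans (by simp)⟩
          (1 / μ x) ⟨hpos.le, (hh1 x hxi).trans (by simp)⟩
        have heq' : g x - 1 / μ x = ε * Real.exp ((L + 1) * x) := by
          rw [heq]; ring
        rw [heq', abs_of_pos hw] at hl
        have hl2 := (abs_le.mp hl).2
        have hi := hineq x hx.1
        have hc := hcond x hx.1
        have e1 : (1 / μ x) * (γ x - μ' x / μ x) = γ x * (1 / μ x) + -μ' x / μ x ^ 2 := by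
          field_simp
          ring
        rw [e1] at hc
        have hγw : 0 ≤ γ x * (g x - 1 / μ x) := by
          rw [heq']; exact mul_nonneg (hγnonneg x hx.1) hw.le
        nlinarith
    refine le_of_forall_pos_le_add fun δ hδ => ?_
    have hE := Real.exp_pos ((L + 1) * T)
    have := main (δ / Real.exp ((L + 1) * T)) (by positivity)
    rwa [div_mul_cancel₀ _ hE.ne'] at this
  have hlim : Tendsto (fun t => 1 / μ t) atTop (nhds 0) := by
    simp only [one_div]
    exact hμtop.inv_tendsto_atTop
  refine tendsto_of_tendsto_of_tendsto_of_le_of_le' tendsto_const_nhds hlim ?_ ?_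
  · filter_upwards [eventually_ge_atTop 0] with t ht using hgnonneg t ht
  · filter_upwards [eventually_gt_atTop 0] with t ht using key t ht
end

section
/- Let (g_n)_{n≥0}, (γ_n), (β_n), (h_n) be sequences of real numbers with g_n ≥ 0, h_n > 0, 0 < h_nγ_n < 1, β_n ≥ 0, and let α : ℕ × [0,∞) → ℝ satisfy α(n, g) ≥ 0 and α(n, g) ≥ α(n, p) whenever g ≥ p ≥ 0. Assume g_{n+1} ≤ (1 − h_nγ_n)g_n + h_n α(n, g_n) + h_n β_n for all n ≥ 0. If there exists a sequence μ_n > 0 such that α(n, 1/μ_n) + β_n ≤ (1/μ_n)·(γ_n − (μ_{n+1} − μ_n)/(h_n μ_n)) for all n ≥ 0, and g_0 ≤ 1/μ_0, then 0 ≤ g_n ≤ 1/μ_n for all n ≥ 0. -/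
/-- Theorem 2 of the paper (discrete version of the nonlinear inequality): if
`g_{n+1} ≤ (1 - h_n γ_n) g_n + h_n α(n, g_n) + h_n β_n` with `g_n ≥ 0`, `h_n > 0`,
`0 < h_n γ_n < 1`, `α(n, ·) ≥ 0` nondecreasing, and there is a sequence `μ_n > 0` with
`α(n, 1/μ_n) + β_n ≤ (1/μ_n)(γ_n - (μ_{n+1} - μ_n)/(h_n μ_n))` and `g_0 ≤ 1/μ_0`,
then `0 ≤ g_n ≤ 1/μ_n` for all `n`. -/
theorem discrete_nonlinear_inequality
    (g γ β h μ : ℕ → ℝ) (α : ℕ → ℝ → ℝ)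
    (hg : ∀ n, 0 ≤ g n)
    (hh : ∀ n, 0 < h n)
    (hhγ : ∀ n, 0 < h n * γ n ∧ h n * γ n < 1)
    (hβ : ∀ n, 0 ≤ β n)
    (hα0 : ∀ n, ∀ x : ℝ, 0 ≤ x → 0 ≤ α n x)
    (hαmono : ∀ n, ∀ x y : ℝ, 0 ≤ y → y ≤ x → α n y ≤ α n x)
    (hrec : ∀ n, g (n + 1) ≤ (1 - h n * γ n) * g n + h n * α n (g n) + h n * β n)
    (hμ : ∀ n, 0 < μ n)
    (hcond : ∀ n, α n (1 / μ n) + β n ≤ (1 / μ n) * (γ n - (μ (n + 1) - μ n) / (h n * μ n)))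
    (hinit : g 0 ≤ 1 / μ 0) :
    ∀ n, 0 ≤ g n ∧ g n ≤ 1 / μ n := by
  intro n
  refine ⟨hg n, ?_⟩
  induction n with
  | zero => exact hinit
  | succ n ih =>
    have hm := hμ n
    have hm' := hμ (n + 1)
    have hn := hh n
    have h1 := hαmono n _ _ (hg n) ih
    have h2 : (1 - h n * γ n) * g n ≤ (1 - h n * γ n) * (1 / μ n) :=
      mul_le_mul_of_nonneg_left ih (by linarith [(hhγ n).2])
    have h3 : h n * α n (g n) ≤ h n * α n (1 / μ n) := mul_le_mul_of_nonneg_left h1 hn.le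
    have h4 := mul_le_mul_of_nonneg_left (hcond n) hn.le
    have h5 : h n * ((1 / μ n) * (γ n - (μ (n + 1) - μ n) / (h n * μ n)))
        = h n * γ n * (1 / μ n) - (μ (n + 1) - μ n) / μ n ^ 2 := by
      field_simp
    have h6 : 1 / μ (n + 1) - (1 / μ n - (μ (n + 1) - μ n) / μ n ^ 2)
        = (μ (n + 1) - μ n) ^ 2 / (μ (n + 1) * μ n ^ 2) := by
      field_simp
      ring
    have h7 : 0 ≤ (μ (n + 1) - μ n) ^ 2 / (μ (n + 1) * μ n ^ 2) := by positivity
    have h8 := hrec n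
    rw [h5] at h4
    linarith
end
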